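/- arXiv:2006.16815 — 2 statements merged into one kernel-verified Lean document; each statement's English description precedes it below -/
import Mathlib

section
/- For odd d ≥ 5, the unique positive root c_d of Q_d(λ) = q_d q_{d-2} − q_{d-1}^2 satisfies c_d ≥ √((d-3)/6). In particular, c_d → ∞ as d → ∞. -/
open Finset SimpleGraph

noncomputable section

/-- `M` is a matching of `G`: a finset of edges of `G`, pairwise vertex-disjoint. -/
def IsMatchingSet {V : Type*} (G : SimpleGraph V) (M : Finset (Sym2 V)) : Prop :=
  (∀ e ∈ M, e ∈ G.edgeSet) ∧
    ∀ e ∈ M, ∀ f ∈ M, e ≠ f → ∀ v : V, ¬(v ∈ e ∧ v ∈ f)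

/-- The finset of all matchings of `G`. -/
def matchingsOf {V : Type*} [Fintype V] (G : SimpleGraph V) : Finset (Finset (Sym2 V)) := by
  classical exact Finset.univ.filter fun M => IsMatchingSet G M

/-- `m_k(G)`: the number of matchings of size `k` in `G`. -/
def mCount {V : Type*} [Fintype V] (G : SimpleGraph V) (k : ℕ) : ℕ := by
  classical exact ((matchingsOf G).filter fun M => M.card = k).card

/-- The matching generating polynomial (partition function) `M_G(λ) = ∑_M λ^{|M|}`. -/
def matchingGen {V : Type*} [Fintype V] (G : SimpleGraph V) (lam : ℝ) : ℝ :=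
  ∑ M ∈ matchingsOf G, lam ^ M.card

/-- `q n` : the matching generating polynomial of the complete graph `K_n`. -/
def q (n : ℕ) (lam : ℝ) : ℝ := matchingGen (⊤ : SimpleGraph (Fin n)) lam

/-- `Q_d(λ) = q_d(λ)·q_{d-2}(λ) − q_{d-1}(λ)²`. -/
def Q (d : ℕ) (lam : ℝ) : ℝ := q d lam * q (d - 2) lam - (q (d - 1) lam) ^ 2

/-- The matchings of the complete graph on `V` all of whose edges lie inside `S`. -/
def completeMatchingsIn {V : Type*} [Fintype V] (S : Finset V) : Finset (Finset (Sym2 V)) := by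
  classical exact (matchingsOf (⊤ : SimpleGraph V)).filter fun M => ∀ e ∈ M, ∀ v ∈ e, v ∈ S

section Recurrence

open scoped Classical

variable {V : Type*} [Fintype V]

lemma mem_completeMatchingsIn {S : Finset V} {M : Finset (Sym2 V)} :
    M ∈ completeMatchingsIn S ↔
      (∀ e ∈ M, ¬ e.IsDiag) ∧
        (∀ e ∈ M, ∀ f ∈ M, ∀ v ∈ e, v ∈ f → e = f) ∧ ∀ e ∈ M, ∀ v ∈ e, v ∈ S := by
  simp only [completeMatchingsIn, matchingsOf, IsMatchingSet, mem_filter, mem_univ, true_and,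
    edgeSet_top, Set.mem_compl_iff, Sym2.mem_diagSet, and_assoc]
  refine and_congr_right fun _ => and_congr_left fun _ => ?_
  exact ⟨fun h e he f hf v hv hv' => by_contra fun hne => h e he f hf hne v ⟨hv, hv'⟩,
    fun h e he f hf hne v hv => hne (h e he f hf v hv.1 hv.2)⟩

lemma completeMatchingsIn_mono {S T : Finset V} (h : S ⊆ T) :
    completeMatchingsIn S ⊆ completeMatchingsIn T := fun M hM => by
  rw [mem_completeMatchingsIn] at hM ⊢
  exact ⟨hM.1, hM.2.1, fun e he v hv => h (hM.2.2 e he v hv)⟩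

lemma notMem_of_mem_completeMatchingsIn {S : Finset V} {M : Finset (Sym2 V)} {a b : V}
    (ha : a ∉ S) (hM : M ∈ completeMatchingsIn S) : s(a, b) ∉ M := fun h =>
  ha ((mem_completeMatchingsIn.1 hM).2.2 _ h a (Sym2.mem_mk_left a b))

lemma insert_mem_completeMatchingsIn {S : Finset V} {N : Finset (Sym2 V)} {a b : V}
    (ha : a ∉ S) (hb : b ∈ S) (hN : N ∈ completeMatchingsIn (S.erase b)) :
    insert s(a, b) N ∈ completeMatchingsIn (insert a S) := by
  rw [mem_completeMatchingsIn] at hN ⊢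
  obtain ⟨hdiag, hdisj, hsub⟩ := hN
  have hab : a ≠ b := fun h => ha (h ▸ hb)
  have hne : ∀ f ∈ N, ∀ v ∈ f, v ∉ s(a, b) := by
    intro f hf v hv hv'
    have := mem_erase.1 (hsub f hf v hv)
    rcases Sym2.mem_iff.1 hv' with rfl | rfl
    · exact ha this.2
    · exact this.1 rfl
  refine ⟨?_, ?_, ?_⟩
  · simpa [forall_mem_insert, hab] using hdiag
  · intro e he f hf v hve hvf
    rcases mem_insert.1 he with rfl | he <;> rcases mem_insert.1 hf with rfl | hf
    · rfl
    · exact absurd hve (hne f hf v hvf)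
    · exact absurd hvf (hne e he v hve)
    · exact hdisj e he f hf v hve hvf
  · intro e he v hv
    rcases mem_insert.1 he with rfl | he
    · rcases Sym2.mem_iff.1 hv with rfl | rfl
      · exact mem_insert_self _ _
      · exact mem_insert_of_mem hb
    · exact mem_insert_of_mem (mem_of_mem_erase (hsub e he v hv))

lemma erase_mem_completeMatchingsIn {S : Finset V} {M : Finset (Sym2 V)} {a b : V}
    (hM : M ∈ completeMatchingsIn (insert a S)) (hab : s(a, b) ∈ M) :
    M.erase s(a, b) ∈ completeMatchingsIn (S.erase b) := by
  rw [mem_completeMatchingsIn] at hM ⊢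
  obtain ⟨hdiag, hdisj, hsub⟩ := hM
  refine ⟨fun e he => hdiag e (mem_of_mem_erase he), fun e he f hf =>
    hdisj e (mem_of_mem_erase he) f (mem_of_mem_erase hf), fun e he v hv => ?_⟩
  obtain ⟨hne, he⟩ := mem_erase.1 he
  have hv' : v ∉ s(a, b) := fun h => hne (hdisj e he _ hab v hv h)
  rw [Sym2.mem_iff, not_or] at hv'
  exact mem_erase.2 ⟨hv'.2, mem_of_mem_insert_of_ne (hsub e he v hv) hv'.1⟩

lemma completeMatchingsIn_insert {S : Finset V} {a : V} (ha : a ∉ S) :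
    completeMatchingsIn (insert a S) = completeMatchingsIn S ∪
      S.biUnion fun b => (completeMatchingsIn (S.erase b)).image (insert s(a, b)) := by
  ext M
  simp only [mem_union, mem_biUnion, mem_image]
  constructor
  · intro hM
    by_cases h : ∃ b, s(a, b) ∈ M
    · obtain ⟨b, hb⟩ := h
      have hM' := mem_completeMatchingsIn.1 hM
      have hba : b ≠ a := by
        rintro rfl
        exact hM'.1 _ hb (Sym2.mk_isDiag_iff.2 rfl)
      exact .inr ⟨b, mem_of_mem_insert_of_ne (hM'.2.2 _ hb b (Sym2.mem_mk_right a b)) hba, _,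
        erase_mem_completeMatchingsIn hM hb, insert_erase hb⟩
    · left
      rw [mem_completeMatchingsIn] at hM ⊢
      refine ⟨hM.1, hM.2.1, fun e he v hv => mem_of_mem_insert_of_ne (hM.2.2 e he v hv) ?_⟩
      rintro rfl
      obtain ⟨b, rfl⟩ := Sym2.mem_iff_exists.1 hv
      exact h ⟨b, he⟩
  · rintro (hM | ⟨b, hb, N, hN, rfl⟩)
    · exact completeMatchingsIn_mono (subset_insert a S) hM
    · exact insert_mem_completeMatchingsIn ha hb hN

lemma sum_completeMatchingsIn_insert {S : Finset V} {a : V} (ha : a ∉ S) (x : ℝ) :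
    ∑ M ∈ completeMatchingsIn (insert a S), x ^ M.card =
      ∑ M ∈ completeMatchingsIn S, x ^ M.card +
        ∑ b ∈ S, x * ∑ M ∈ completeMatchingsIn (S.erase b), x ^ M.card := by
  have hnot {b b' : V} {N : Finset (Sym2 V)} (hN : N ∈ completeMatchingsIn (S.erase b)) :
      s(a, b') ∉ N :=
    notMem_of_mem_completeMatchingsIn (fun h => ha (mem_of_mem_erase h)) hN
  rw [completeMatchingsIn_insert ha, sum_union, sum_biUnion]
  · congr 1
    refine sum_congr rfl fun b _ => ?_
    rw [sum_image, mul_sum]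
    · refine sum_congr rfl fun N hN => ?_
      rw [card_insert_of_notMem (hnot hN), pow_succ']
    · intro N hN N' hN' h
      rw [← erase_insert (hnot (b' := b) hN), ← erase_insert (hnot (b' := b) hN'), h]
  · intro b _ b' _ hne
    refine disjoint_left.2 fun M hM hM' => ?_
    obtain ⟨N, hN, rfl⟩ := mem_image.1 hM
    obtain ⟨N', hN', h⟩ := mem_image.1 hM'
    have hmem : s(a, b) ∈ insert s(a, b') N' := h ▸ mem_insert_self _ _
    rcases mem_insert.1 hmem with h | h
    · exact hne (Sym2.congr_right.1 h)
    · exact hnot hN' h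
  · refine disjoint_left.2 fun M hM hM' => ?_
    obtain ⟨b, _, hM'⟩ := mem_biUnion.1 hM'
    obtain ⟨N, _, rfl⟩ := mem_image.1 hM'
    exact notMem_of_mem_completeMatchingsIn ha hM (mem_insert_self _ _)

end Recurrence

/-- The polynomials given by the recurrence `p (n + 2) = p (n + 1) + (n + 1) x p n`. -/
def matchingRec (x : ℝ) : ℕ → ℝ
  | 0 => 1
  | 1 => 1
  | n + 2 => matchingRec x (n + 1) + (n + 1) * x * matchingRec x n

lemma sum_completeMatchingsIn {V : Type*} [Fintype V] (x : ℝ) (n : ℕ) :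
    ∀ S : Finset V, S.card = n →
      ∑ M ∈ completeMatchingsIn S, x ^ M.card = matchingRec x n := by
  classical
  have hempty : completeMatchingsIn (∅ : Finset V) = {∅} := by
    ext M
    rw [mem_completeMatchingsIn, mem_singleton]
    refine ⟨fun h => eq_empty_of_forall_notMem fun e he => ?_, by rintro rfl; simp⟩
    induction e with
    | _ a b => exact notMem_empty a (h.2.2 _ he a (Sym2.mem_mk_left a b))
  induction n using Nat.twoStepInduction with
  | zero =>
    intro S hS
    simp [card_eq_zero.1 hS, hempty, matchingRec]
  | one =>
    intro S hS
    obtain ⟨a, rfl⟩ := card_eq_one.1 hS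
    rw [← insert_empty_eq, sum_completeMatchingsIn_insert (notMem_empty a)]
    simp [hempty, matchingRec]
  | more n ih₀ ih₁ =>
    intro S hS
    obtain ⟨a, T, ha, rfl, hT⟩ := card_eq_succ.1 hS
    rw [sum_completeMatchingsIn_insert ha, ih₁ T hT,
      sum_congr rfl fun b hb => by rw [ih₀ (T.erase b) (by rw [card_erase_of_mem hb, hT]; rfl)]]
    simp [hT, matchingRec, mul_assoc]

lemma q_eq_matchingRec (n : ℕ) (x : ℝ) : q n x = matchingRec x n := by
  rw [← sum_completeMatchingsIn x n (univ : Finset (Fin n)) (card_fin n)]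
  simp [q, matchingGen, completeMatchingsIn]

lemma q_zero (x : ℝ) : q 0 x = 1 := by rw [q_eq_matchingRec, matchingRec]

lemma q_one (x : ℝ) : q 1 x = 1 := by rw [q_eq_matchingRec, matchingRec]

lemma q_add_two (n : ℕ) (x : ℝ) : q (n + 2) x = q (n + 1) x + (n + 1) * x * q n x := by
  simp only [q_eq_matchingRec, matchingRec]

/-- The odd double factorial `(2m+1)!!`, as a real number. -/
def oddFactorial : ℕ → ℝ
  | 0 => 1
  | m + 1 => (2 * m + 3) * oddFactorial m

lemma oddFactorial_pos (m : ℕ) : 0 < oddFactorial m := by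
  induction m with
  | zero => simp [oddFactorial]
  | succ m ih => rw [oddFactorial]; positivity

lemma le_q_even_odd {x : ℝ} (hx : 0 < x) (m : ℕ) :
    oddFactorial m * x ^ m ≤ (2 * m + 1) * q (2 * m) x ∧
      oddFactorial m * x ^ m ≤ q (2 * m + 1) x := by
  induction m with
  | zero => simp [oddFactorial, q_zero, q_one]
  | succ m ih =>
    obtain ⟨he, ho⟩ := ih
    have h₁ := q_add_two (2 * m) x
    have h₂ := q_add_two (2 * m + 1) x
    have hpos : 0 < oddFactorial m * x ^ m := mul_pos (oddFactorial_pos m) (pow_pos hx m)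
    rw [show 2 * (m + 1) = 2 * m + 2 by ring]
    rw [show 2 * m + 1 + 2 = 2 * m + 2 + 1 by ring, show 2 * m + 1 + 1 = 2 * m + 2 by ring] at h₂
    push_cast at h₁ h₂ ⊢
    have hlead : oddFactorial m * x ^ m * x ≤ q (2 * m + 2) x := by
      rw [h₁]
      nlinarith [mul_le_mul_of_nonneg_right he hx.le]
    have hfac : oddFactorial (m + 1) * x ^ (m + 1) =
        (2 * m + 3) * (oddFactorial m * x ^ m * x) := by rw [oddFactorial]; ring
    rw [hfac]
    constructor
    · have := mul_le_mul_of_nonneg_left hlead (show (0 : ℝ) ≤ 2 * m + 3 by positivity)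
      linarith
    · have := mul_le_mul_of_nonneg_left ho (show (0 : ℝ) ≤ (2 * m + 2) * x by positivity)
      rw [h₂]
      linarith

lemma le_sq_q_odd_sub_sq_q_even {x : ℝ} (hx : 0 < x) (m : ℕ) :
    oddFactorial m ^ 2 * (m * x ^ (2 * m) - x ^ (2 * m + 2)) ≤
      (2 * m + 1) * x * (q (2 * m + 1) x ^ 2 - (2 * m + 1) * x * q (2 * m) x ^ 2) := by
  induction m with
  | zero => simp [oddFactorial, q_zero, q_one]; nlinarith
  | succ m ih =>
    have h₁ := q_add_two (2 * m) x
    have h₂ := q_add_two (2 * m + 1) x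
    have hq := (le_q_even_odd hx m).2
    rw [show 2 * (m + 1) = 2 * m + 2 by ring]
    rw [show 2 * m + 1 + 2 = 2 * m + 2 + 1 by ring, show 2 * m + 1 + 1 = 2 * m + 2 by ring] at h₂
    push_cast at h₁ h₂ ⊢
    have hsq : (oddFactorial m * x ^ m) ^ 2 ≤ q (2 * m + 1) x ^ 2 :=
      pow_le_pow_left₀ (mul_pos (oddFactorial_pos m) (pow_pos hx m)).le hq 2
    -- The gap to the previous case is `(q (2m+2) - x q (2m+1))² + (2m+3) x q (2m+1)²`.
    have hstep : q (2 * m + 2 + 1) x ^ 2 - (2 * m + 3) * x * q (2 * m + 2) x ^ 2 =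
        (2 * m + 1) * (2 * m + 3) * x ^ 2 *
          (q (2 * m + 1) x ^ 2 - (2 * m + 1) * x * q (2 * m) x ^ 2) +
        (q (2 * m + 2) x - x * q (2 * m + 1) x) ^ 2 +
        (2 * m + 3) * x * q (2 * m + 1) x ^ 2 := by
      rw [h₂, h₁]; ring
    have hprev := mul_le_mul_of_nonneg_left ih
      (show (0 : ℝ) ≤ (2 * m + 3) ^ 2 * x ^ 2 by positivity)
    have hgap := mul_le_mul_of_nonneg_left hsq
      (show (0 : ℝ) ≤ (2 * m + 3) ^ 2 * x ^ 2 by positivity)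
    have hrest : 0 ≤ (2 * m + 3) * x * (q (2 * m + 2) x - x * q (2 * m + 1) x) ^ 2 := by
      positivity
    have hfac : oddFactorial (m + 1) ^ 2 *
          ((m + 1) * x ^ (2 * m + 2) - x ^ (2 * m + 2 + 2)) =
        (2 * m + 3) ^ 2 * x ^ 2 *
          (oddFactorial m ^ 2 * (m * x ^ (2 * m) - x ^ (2 * m + 2))) +
        (2 * m + 3) ^ 2 * x ^ 2 * (oddFactorial m * x ^ m) ^ 2 := by
      rw [oddFactorial]; ring
    rw [hfac, show (2 * ((m : ℝ) + 1) + 1) = 2 * m + 3 by ring, hstep]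
    linarith

lemma Q_add_four (n : ℕ) (x : ℝ) :
    Q (n + 4) x = x * (q (n + 2) x ^ 2 - (n + 2) * x * q (n + 1) x ^ 2) +
      (n + 2) * (n + 1) * x ^ 2 * Q (n + 2) x := by
  have h₂ := q_add_two n x
  have h₃ := q_add_two (n + 1) x
  have h₄ := q_add_two (n + 2) x
  push_cast at h₂ h₃ h₄
  simp only [Q, show n + 4 - 2 = n + 2 by omega, show n + 4 - 1 = n + 3 by omega,
    show n + 2 - 2 = n by omega, show n + 2 - 1 = n + 1 by omega]
  rw [show n + 4 = n + 2 + 2 by ring, h₄, show n + 2 + 1 = n + 1 + 2 by ring,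
    show n + 3 = n + 1 + 2 by ring, h₃, show n + 1 + 1 = n + 2 by ring, h₂]
  ring

lemma le_Q_odd {x : ℝ} (hx : 0 < x) (m : ℕ) :
    oddFactorial m ^ 2 * (m / 3 * x ^ (2 * m) - x ^ (2 * m + 2)) ≤ Q (2 * m + 3) x := by
  induction m with
  | zero =>
    have h₂ := q_add_two 0 x
    have h₃ := q_add_two 1 x
    norm_num [q_zero, q_one] at h₂ h₃
    norm_num [Q, oddFactorial, h₂, h₃, q_one]
    nlinarith
  | succ m ih =>
    have hR := le_sq_q_odd_sub_sq_q_even hx (m + 1)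
    have hQ := Q_add_four (2 * m + 1) x
    rw [show 2 * (m + 1) = 2 * m + 2 by ring] at hR ⊢
    rw [show 2 * m + 1 + 4 = 2 * m + 2 + 3 by ring, show 2 * m + 1 + 2 = 2 * m + 2 + 1 by ring,
      show 2 * m + 1 + 1 = 2 * m + 2 by ring, show 2 * m + 2 + 1 = 2 * m + 3 by ring] at hQ
    rw [show 2 * m + 2 + 1 = 2 * m + 3 by ring] at hR
    push_cast at hR hQ ⊢
    have hprev := mul_le_mul_of_nonneg_left ih
      (show (0 : ℝ) ≤ (2 * m + 3) ^ 2 * (2 * m + 2) * x ^ 2 by positivity)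
    refine le_of_mul_le_mul_left ?_ (show (0 : ℝ) < 2 * m + 3 by positivity)
    have hfac : (2 * m + 3) * (oddFactorial (m + 1) ^ 2 *
          ((m + 1) / 3 * x ^ (2 * m + 2) - x ^ (2 * m + 2 + 2))) =
        oddFactorial (m + 1) ^ 2 * ((m + 1) * x ^ (2 * m + 2) - x ^ (2 * m + 2 + 2)) +
        (2 * m + 3) ^ 2 * (2 * m + 2) * x ^ 2 *
          (oddFactorial m ^ 2 * (m / 3 * x ^ (2 * m) - x ^ (2 * m + 2))) := by
      rw [oddFactorial]; ring
    rw [hfac, hQ]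
    linarith

lemma sqrt_le_of_Q_eq_zero {d : ℕ} (hd : 5 ≤ d) (hodd : Odd d) {c : ℝ} (hc : 0 < c)
    (hQ : Q d c = 0) : Real.sqrt (((d : ℝ) - 3) / 6) ≤ c := by
  obtain ⟨m, rfl⟩ : ∃ m, d = 2 * m + 3 := by
    obtain ⟨k, rfl⟩ := hodd
    exact ⟨k - 1, by omega⟩
  have h := le_Q_odd hc m
  rw [hQ, show oddFactorial m ^ 2 * (m / 3 * c ^ (2 * m) - c ^ (2 * m + 2)) =
    oddFactorial m ^ 2 * c ^ (2 * m) * (m / 3 - c ^ 2) by ring] at h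
  have hpos : 0 < oddFactorial m ^ 2 * c ^ (2 * m) :=
    mul_pos (pow_pos (oddFactorial_pos m) 2) (pow_pos hc _)
  have h' := nonpos_of_mul_nonpos_right h hpos
  refine Real.sqrt_le_iff.2 ⟨hc.le, ?_⟩
  push_cast
  linarith

/-- for odd `d ≥ 5`, any positive root of `Q_d` is at least
`√((d-3)/6)`; in particular, for any choice `c` of positive roots of `Q_d`
(for odd `d`), `c_d → ∞` as `d → ∞`. -/
theorem positive_root_lower_bound (d : ℕ) (hd : 5 ≤ d) (hodd : Odd d) :
    (∀ c : ℝ, 0 < c → Q d c = 0 → Real.sqrt (((d : ℝ) - 3) / 6) ≤ c) ∧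
    (∀ c : ℕ → ℝ, (∀ m : ℕ, Odd m → 5 ≤ m → 0 < c m ∧ Q m (c m) = 0) →
      Filter.Tendsto (fun k : ℕ => c (2 * k + 5)) Filter.atTop Filter.atTop) := by
  refine ⟨fun c hc hQ => sqrt_le_of_Q_eq_zero hd hodd hc hQ, fun c hc => ?_⟩
  have hlin : Filter.Tendsto (fun k : ℕ => (k : ℝ) / 3) Filter.atTop Filter.atTop :=
    tendsto_natCast_atTop_atTop.atTop_div_const (by norm_num)
  refine Filter.tendsto_atTop_mono (fun k => ?_) (Real.tendsto_sqrt_atTop.comp hlin)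
  have hk : Odd (2 * k + 5) := ⟨k + 2, by ring⟩
  obtain ⟨hpos, hQ⟩ := hc (2 * k + 5) hk (by omega)
  refine le_trans (Real.sqrt_le_sqrt ?_) (sqrt_le_of_Q_eq_zero (by omega) hk hpos hQ)
  push_cast
  linarith
end
end

section
/- Let d be even, and let λ ≥ exp((d+1)(d+3)·ln(d+1)). Then for every d-regular graph G, (1/v(G))·ln M_G(λ) ≥ (1/(d+1))·ln M_{K_{d+1}}(λ). -/
open Finset SimpleGraph

noncomputable section

section Deficiency

open scoped Classical

variable {V : Type*} [Fintype V]

/-- The number of ordered adjacent pairs inside a vertex set is even. -/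
lemma even_sum_card_adj_inside (G : SimpleGraph V) (A : Finset V) :
    Even (∑ v ∈ A, #{w ∈ A | G.Adj v w}) := by
  let H : SimpleGraph V :=
    { Adj := fun v w => v ∈ A ∧ w ∈ A ∧ G.Adj v w
      symm := ⟨fun v w h => ⟨h.2.1, h.1, h.2.2.symm⟩⟩
      loopless := ⟨fun v h => G.loopless.irrefl v h.2.2⟩ }
  have key : ∑ v, H.degree v = ∑ v ∈ A, #{w ∈ A | G.Adj v w} := by
    rw [← Finset.sum_subset (Finset.subset_univ A)]
    · refine Finset.sum_congr rfl fun v hv => ?_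
      rw [← SimpleGraph.card_neighborFinset_eq_degree]
      congr 1
      ext w
      simp [H, hv]
    · intro v _ hv
      rw [← SimpleGraph.card_neighborFinset_eq_degree, Finset.card_eq_zero]
      ext w
      simp [H, hv]
  rw [← key, H.sum_degrees_eq_twice_card_edges]
  exact even_two_mul _

lemma odd_set_edge_boundary {G : SimpleGraph V} {d : ℕ} (hd : Even d) (hd2 : 2 ≤ d)
    (hreg : ∀ v, #{w | G.Adj v w} = d) {A S : Finset V} (hdis : Disjoint A S)
    (hAS : ∀ v ∈ A, ∀ w, G.Adj v w → w ∈ A ∨ w ∈ S) (hodd : Odd #A)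
    (hcl : ∀ B : Finset V, #B = d + 1 → ¬ ∀ v ∈ B, ∀ w, G.Adj v w → w ∈ B) :
    d * (d + 3) ≤ d * #A + (d + 3) * ∑ v ∈ A, #{w ∈ S | G.Adj v w} := by
  have hsplit : ∀ v ∈ A, #{w ∈ A | G.Adj v w} + #{w ∈ S | G.Adj v w} = d := by
    intro v hv
    rw [← hreg v, ← Finset.card_union_of_disjoint
      (Finset.disjoint_filter_filter hdis), ← Finset.filter_union]
    congr 1
    ext w
    simp only [mem_filter, mem_union, mem_univ, true_and, and_iff_right_iff_imp]
    exact hAS v hv w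
  have hin : ∀ v ∈ A, #{w ∈ A | G.Adj v w} + 1 ≤ #A := by
    intro v hv
    rw [Nat.add_one_le_iff]
    refine Finset.card_lt_card ((Finset.filter_ssubset).2 ⟨v, hv, G.loopless.irrefl v⟩)
  set e := ∑ v ∈ A, #{w ∈ S | G.Adj v w} with he
  have htot : (∑ v ∈ A, #{w ∈ A | G.Adj v w}) + e = #A * d := by
    rw [he, ← Finset.sum_add_distrib, Finset.sum_congr rfl hsplit, Finset.sum_const, smul_eq_mul]
  have heven : Even e := by
    have h1 := even_sum_card_adj_inside G A
    have h2 : Even ((∑ v ∈ A, #{w ∈ A | G.Adj v w}) + e) := htot ▸ hd.mul_left _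
    exact (Nat.even_add.1 h2).1 h1
  have hpos : 1 ≤ #A := hodd.pos
  rcases Nat.lt_or_ge d #A with hbig | hsmall
  · rcases Nat.eq_zero_or_pos e with h0 | h0
    · have hne : #A ≠ d + 1 := by
        intro h
        refine hcl A h fun v hv w hvw => (hAS v hv w hvw).resolve_right fun hw => ?_
        have := (Finset.sum_eq_zero_iff.1 (he.symm.trans h0)) v hv
        rw [Finset.card_eq_zero, Finset.filter_eq_empty_iff] at this
        exact this hw hvw
      have : d + 3 ≤ #A := by
        rcases hd with ⟨k, hk⟩
        rcases hodd with ⟨l, hl⟩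
        omega
      nlinarith
    · have h2 : 2 ≤ e := by
        rcases heven with ⟨k, hk⟩
        omega
      nlinarith
  · have hle : #A * (d + 1 - #A) ≤ e := by
      rw [he, ← smul_eq_mul, ← Finset.sum_const]
      refine Finset.sum_le_sum fun v hv => ?_
      have := hsplit v hv
      have := hin v hv
      omega
    have hde : d ≤ e := by
      refine le_trans ?_ hle
      obtain ⟨b, hb⟩ := Nat.exists_eq_add_of_le hsmall
      have : d + 1 - #A = b + 1 := by omega
      rw [this]
      nlinarith
    nlinarith

/-- The counting half of the Tutte–Berge argument. -/
lemma card_odd_family_le {ι : Type*} [Fintype ι] {G : SimpleGraph V} {d : ℕ} (hd : Even d)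
    (hd2 : 2 ≤ d) (hreg : ∀ v, #{w | G.Adj v w} = d) (A : ι → Finset V) (S : Finset V)
    (hpair : Pairwise (Function.onFun Disjoint A)) (hdis : ∀ i, Disjoint (A i) S)
    (hAS : ∀ i, ∀ v ∈ A i, ∀ w, G.Adj v w → w ∈ A i ∨ w ∈ S) (hodd : ∀ i, Odd #(A i))
    (hcl : ∀ B : Finset V, #B = d + 1 → ¬ ∀ v ∈ B, ∀ w, G.Adj v w → w ∈ B) :
    Fintype.card ι * (d + 3) ≤ Fintype.card V + #S * (d + 3) := by
  have h1 : ∑ i : ι, d * (d + 3) ≤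
      ∑ i, (d * #(A i) + (d + 3) * ∑ v ∈ A i, #{w ∈ S | G.Adj v w}) :=
    Finset.sum_le_sum fun i _ =>
      odd_set_edge_boundary hd hd2 hreg (hdis i) (hAS i) (hodd i) hcl
  rw [Finset.sum_add_distrib, ← Finset.mul_sum, ← Finset.mul_sum, ← Finset.mul_sum, Finset.sum_const,
    smul_eq_mul, Finset.card_univ,
    ← Finset.card_biUnion (fun i _ j _ hij => hpair hij),
    ← Finset.sum_biUnion (fun i _ j _ hij => hpair hij)] at h1
  set U := Finset.univ.biUnion A
  have h2 : ∑ v ∈ U, #{w ∈ S | G.Adj v w} ≤ #S * d := by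
    have := Finset.sum_card_bipartiteAbove_eq_sum_card_bipartiteBelow (s := U) (t := S) G.Adj
    simp only [Finset.bipartiteAbove, Finset.bipartiteBelow] at this
    rw [this, ← smul_eq_mul, ← Finset.sum_const]
    refine Finset.sum_le_sum fun w _ => ?_
    rw [← hreg w]
    refine Finset.card_le_card fun v hv => ?_
    simpa using (Finset.mem_filter.1 hv).2.symm
  have h3 : #U ≤ Fintype.card V := Finset.card_le_univ U
  have h4 : d * (Fintype.card ι * (d + 3)) ≤ d * (Fintype.card V + #S * (d + 3)) := by
    nlinarith
  exact Nat.le_of_mul_le_mul_left h4 (by omega)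

end Deficiency

section Matching

open scoped Classical

/-- The join of `G` with a complete graph on `t` new vertices. -/
def joinTop {V : Type*} (G : SimpleGraph V) (t : ℕ) : SimpleGraph (V ⊕ Fin t) :=
  (Gᶜ.sum ⊥)ᶜ

@[simp]
lemma joinTop_adj_inl_inl {V : Type*} (G : SimpleGraph V) (t : ℕ) (v w : V) :
    (joinTop G t).Adj (Sum.inl v) (Sum.inl w) ↔ G.Adj v w := by
  have := G.ne_of_adj (a := v) (b := w)
  simp only [joinTop, SimpleGraph.compl_adj, SimpleGraph.sum_adj_inl, ne_eq, Sum.inl.injEq]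
  tauto

lemma joinTop_adj_inr {V : Type*} (G : SimpleGraph V) (t : ℕ) (x : V ⊕ Fin t) (j : Fin t) :
    (joinTop G t).Adj x (Sum.inr j) ↔ x ≠ Sum.inr j := by
  cases x <;> simp [joinTop]

universe u

variable {V : Type u} [Fintype V]

lemma exists_matching_of_joinTop {G : SimpleGraph V} {t : ℕ} {P : (joinTop G t).Subgraph}
    (hP : P.IsPerfectMatching) :
    ∃ M, IsMatchingSet G M ∧ Fintype.card V ≤ 2 * #M + t := by
  rw [SimpleGraph.Subgraph.isPerfectMatching_iff] at hP
  let H : SimpleGraph V :=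
    { Adj := fun v w => P.Adj (Sum.inl v) (Sum.inl w)
      symm := ⟨fun v w h => h.symm⟩
      loopless := ⟨fun v h => (P.adj_sub h).ne rfl⟩ }
  have huniq : ∀ u v w, H.Adj u v → H.Adj u w → v = w := fun u v w h1 h2 =>
    Sum.inl_injective ((hP (Sum.inl u)).unique h1 h2)
  refine ⟨H.edgeFinset, ⟨?_, ?_⟩, ?_⟩
  · intro e he
    induction e with
    | _ v w =>
      rw [SimpleGraph.mem_edgeFinset, SimpleGraph.mem_edgeSet] at he
      exact (joinTop_adj_inl_inl G t v w).1 (P.adj_sub he)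
  · rintro e he f hf hne v ⟨hve, hvf⟩
    obtain ⟨a, rfl⟩ := Sym2.mem_iff_exists.1 hve
    obtain ⟨b, rfl⟩ := Sym2.mem_iff_exists.1 hvf
    rw [SimpleGraph.mem_edgeFinset, SimpleGraph.mem_edgeSet] at he hf
    exact hne (by rw [huniq v a b he hf])
  · rw [← H.sum_degrees_eq_twice_card_edges]
    set C : Finset V := {v | ∃ w, H.Adj v w}
    have h1 : #C ≤ ∑ v, H.degree v := by
      rw [Finset.card_eq_sum_ones]
      refine (Finset.sum_le_sum fun v hv => ?_).trans
        (Finset.sum_le_sum_of_subset (Finset.subset_univ C))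
      exact (H.degree_pos_iff_exists_adj v).2 (Finset.mem_filter.1 hv).2
    have h2 : #Cᶜ ≤ t := by
      have hex : ∀ v ∈ Cᶜ, ∃ j ∈ (Finset.univ : Finset (Fin t)), P.Adj (Sum.inl v) (Sum.inr j) := by
        intro v hv
        obtain ⟨x, hx, -⟩ := hP (Sum.inl v)
        cases x with
        | inl w => exact absurd hx ((by simpa [C] using hv : ∀ x, ¬ H.Adj v x) w)
        | inr j => exact ⟨j, Finset.mem_univ j, hx⟩
      have := Finset.card_le_card_of_forall_subsingleton
        (s := Cᶜ) (t := (Finset.univ : Finset (Fin t)))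
        (fun v j => P.Adj (Sum.inl v) (Sum.inr j)) hex
        (fun j _ v hv w hw => Sum.inl_injective ((hP (Sum.inr j)).unique hv.2.symm hw.2.symm))
      simpa using this
    have := Finset.card_add_card_compl C
    omega

lemma exists_odd_family (G : SimpleGraph V) (U : Set V) :
    ∃ A : ((⊤ : G.Subgraph).deleteVerts U).coe.oddComponents → Finset V,
      Pairwise (Function.onFun Disjoint A) ∧ (∀ i, ∀ v ∈ A i, v ∉ U) ∧
      (∀ i, ∀ v ∈ A i, ∀ w, G.Adj v w → w ∈ A i ∨ w ∈ U) ∧ ∀ i, Odd #(A i) := by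
  refine ⟨fun i => (Subtype.val '' i.1.supp).toFinset, ?_, ?_, ?_, ?_⟩
  · intro i j hij
    rw [Function.onFun, Set.disjoint_toFinset, Set.disjoint_image_iff Subtype.val_injective]
    exact SimpleGraph.pairwise_disjoint_supp_connectedComponent _
      (fun h => hij (Subtype.ext h))
  · intro i v hv
    rw [Set.mem_toFinset] at hv
    obtain ⟨x, -, rfl⟩ := hv
    exact x.2.2
  · intro i v hv w hvw
    rw [Set.mem_toFinset] at hv ⊢
    obtain ⟨x, hx, rfl⟩ := hv
    by_cases hw : w ∈ U
    · exact Or.inr hw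
    · refine Or.inl ⟨⟨w, ⟨trivial, hw⟩⟩, ?_, rfl⟩
      refine i.1.mem_supp_of_adj_mem_supp hx ?_
      rw [SimpleGraph.Subgraph.coe_adj, SimpleGraph.Subgraph.deleteVerts_adj]
      exact ⟨trivial, x.2.2, trivial, hw, hvw⟩
  · intro i
    rw [← Set.ncard_eq_toFinset_card', Set.ncard_image_of_injective _ Subtype.val_injective]
    exact i.2

lemma IsTutteViolator.add_two_le {W : Type*} [Fintype W] {G : SimpleGraph W} {U : Set W}
    (hU : G.IsTutteViolator U) (hW : Even (Fintype.card W)) :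
    U.ncard + 2 ≤ Nat.card ((⊤ : G.Subgraph).deleteVerts U).coe.oddComponents := by
  have h1 := SimpleGraph.odd_ncard_oddComponents ((⊤ : G.Subgraph).deleteVerts U).coe
  rw [SimpleGraph.IsTutteViolator] at hU
  have h2 : Nat.card ((⊤ : G.Subgraph).deleteVerts U).verts + U.ncard = Fintype.card W := by
    rw [SimpleGraph.Subgraph.deleteVerts_verts, SimpleGraph.Subgraph.verts_top,
      Nat.card_coe_set_eq, ← Nat.card_eq_fintype_card, ← Set.compl_eq_univ_sdiff, add_comm]
    exact Set.ncard_add_ncard_compl U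
  rw [Nat.card_coe_set_eq]
  by_contra hlt
  have h3 : ((⊤ : G.Subgraph).deleteVerts U).coe.oddComponents.ncard = U.ncard + 1 := by omega
  rw [h3] at h1
  have h4 : Odd (U.ncard + 1) ↔ ¬ Odd U.ncard := by
    rw [Nat.odd_add_one]
  rw [← h2] at hW
  have h5 := Nat.even_add.1 hW
  rw [← Nat.not_odd_iff_even, ← Nat.not_odd_iff_even] at h5
  tauto

/-- Berge's half of the Tutte–Berge formula, for a deficiency bound of the right parity. -/
lemma exists_matching_of_odd_family_bound (G : SimpleGraph V) (t : ℕ)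
    (hpar : Even (Fintype.card V + t))
    (hbound : ∀ (ι : Type u) [Fintype ι] (A : ι → Finset V) (S : Finset V),
      Pairwise (Function.onFun Disjoint A) → (∀ i, Disjoint (A i) S) →
      (∀ i, ∀ v ∈ A i, ∀ w, G.Adj v w → w ∈ A i ∨ w ∈ S) → (∀ i, Odd #(A i)) →
      Fintype.card ι < #S + t + 2) :
    ∃ M, IsMatchingSet G M ∧ Fintype.card V ≤ 2 * #M + t := by
  suffices ∃ P : (joinTop G t).Subgraph, P.IsPerfectMatching by
    obtain ⟨P, hP⟩ := this
    exact exists_matching_of_joinTop hP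
  rw [SimpleGraph.tutte]
  intro U hU
  have hcard := IsTutteViolator.add_two_le hU (by simpa using hpar)
  obtain ⟨A, hpair, hdis, hadj, hodd⟩ := exists_odd_family (joinTop G t) U
  by_cases hall : ∀ j, Sum.inr j ∈ U
  · have hinr : ∀ i j, Sum.inr j ∉ A i := fun i j h => hdis i _ h (hall j)
    have himg : ∀ i, ((A i).toLeft).map Function.Embedding.inl = A i := by
      intro i
      ext x
      cases x with
      | inl v => simp
      | inr j => simp [hinr i j]
    have hb := hbound _ (fun i => (A i).toLeft) (U.toFinset).toLeft
      (fun i j hij => by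
        rw [Function.onFun, ← Finset.disjoint_map Function.Embedding.inl, himg, himg]
        exact hpair hij)
      (fun i => Finset.disjoint_left.2 fun v hv hvU =>
        hdis i (Sum.inl v) (Finset.mem_toLeft.1 hv) (by simpa using hvU))
      (fun i v hv w hvw => by
        simpa using hadj i (Sum.inl v) (Finset.mem_toLeft.1 hv) (Sum.inl w)
          ((joinTop_adj_inl_inl G t v w).2 hvw))
      (fun i => by
        rw [← Finset.card_map Function.Embedding.inl, himg]
        exact hodd i)
    have hUcard : U.ncard = #(U.toFinset).toLeft + t := by
      have hr : (U.toFinset).toRight = Finset.univ := by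
        ext j
        simp [hall j]
      rw [Set.ncard_eq_toFinset_card', ← Finset.card_toLeft_add_card_toRight, hr]
      simp
    rw [Nat.card_eq_fintype_card] at hcard
    omega
  · push Not at hall
    obtain ⟨j, hj⟩ := hall
    have hmem : ∀ i, Sum.inr j ∈ A i := by
      intro i
      obtain ⟨x, hx⟩ := Finset.card_pos.1 (hodd i).pos
      by_cases hxj : x = Sum.inr j
      · rwa [← hxj]
      · exact (hadj i x hx _ ((joinTop_adj_inr G t x j).2 hxj)).resolve_right hj
    have : Nat.card ((⊤ : (joinTop G t).Subgraph).deleteVerts U).coe.oddComponents ≤ 1 := by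
      rw [Finite.card_le_one_iff_subsingleton]
      refine ⟨fun a b => ?_⟩
      by_contra hab
      exact Finset.disjoint_left.1 (hpair hab) (hmem a) (hmem b)
    omega

lemma exists_large_matching {G : SimpleGraph V} {d : ℕ} (hd : Even d)
    (hd2 : 2 ≤ d) (hreg : ∀ v, #{w | G.Adj v w} = d)
    (hcl : ∀ B : Finset V, #B = d + 1 → ¬ ∀ v ∈ B, ∀ w, G.Adj v w → w ∈ B) :
    ∃ M, IsMatchingSet G M ∧ (d + 2) * Fintype.card V ≤ 2 * (d + 3) * #M := by
  set n := Fintype.card V with hn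
  obtain ⟨t, hpar, htn, htmax⟩ :
      ∃ t, Even (n + t) ∧ t * (d + 3) ≤ n ∧ n < (t + 2) * (d + 3) := by
    have hodd : Odd n → 1 ≤ n / (d + 3) := by
      intro hodd
      have := card_odd_family_le (ι := Unit) hd hd2 hreg (fun _ => Finset.univ) ∅
        (fun i j hij => absurd rfl hij) (by simp) (by simp) (by simpa using hodd) hcl
      rw [Nat.one_le_div_iff (by omega)]
      simpa using this
    have h1 := Nat.div_mul_le_self n (d + 3)
    have h2 := Nat.lt_div_mul_add (a := n) (b := d + 3) (by omega)
    generalize n / (d + 3) = m at *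
    by_cases hp : Even (n + m)
    · exact ⟨m, hp, h1, by nlinarith⟩
    · have hm : 1 ≤ m := by
        rcases Nat.even_or_odd n with h | h
        · rcases Nat.eq_zero_or_pos m with rfl | h0
          · exact absurd (by simpa using h) hp
          · exact h0
        · exact hodd h
      obtain ⟨k, rfl⟩ := Nat.exists_eq_add_of_le' hm
      refine ⟨k, ?_, by nlinarith, by nlinarith⟩
      rw [← add_assoc, Nat.even_add_one, not_not] at hp
      exact hp
  obtain ⟨M, hM, hcard⟩ := exists_matching_of_odd_family_bound G t hpar
    fun ι _ A S hpair hdis hadj hodd => by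
      have := card_odd_family_le hd hd2 hreg A S hpair hdis hadj hodd hcl
      by_contra hlt
      push Not at hlt
      nlinarith [Nat.mul_le_mul_right (d + 3) hlt]
  exact ⟨M, hM, by nlinarith⟩

end Matching

section MatchingGen

open scoped Classical

variable {V : Type*}

lemma mem_matchingsOf [Fintype V] {G : SimpleGraph V} {M : Finset (Sym2 V)} :
    M ∈ matchingsOf G ↔ IsMatchingSet G M := by
  simp [matchingsOf]

lemma IsMatchingSet.empty (G : SimpleGraph V) : IsMatchingSet G ∅ := by
  simp [IsMatchingSet]

lemma IsMatchingSet.ne {G : SimpleGraph V} {M : Finset (Sym2 V)} (hM : IsMatchingSet G M)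
    {v w : V} (h : s(v, w) ∈ M) : v ≠ w :=
  G.ne_of_adj (hM.1 _ h)

lemma IsMatchingSet.eq_right {G : SimpleGraph V} {M : Finset (Sym2 V)} (hM : IsMatchingSet G M)
    {v a b : V} (ha : s(v, a) ∈ M) (hb : s(v, b) ∈ M) : a = b := by
  by_contra hab
  exact hM.2 _ ha _ hb (fun h => hab (Sym2.congr_right.1 h)) v
    ⟨Sym2.mem_mk_left v a, Sym2.mem_mk_left v b⟩

lemma IsMatchingSet.two_mul_card_le [Fintype V] {G : SimpleGraph V} {M : Finset (Sym2 V)}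
    (hM : IsMatchingSet G M) : 2 * #M ≤ Fintype.card V := by
  have h : #(M.biUnion Sym2.toFinset) = ∑ e ∈ M, 2 := by
    rw [Finset.card_biUnion]
    · exact Finset.sum_congr rfl fun e he =>
        Sym2.card_toFinset_of_not_isDiag e (G.not_isDiag_of_mem_edgeSet (hM.1 e he))
    · intro e he f hf hef
      refine Finset.disjoint_left.2 fun v hve hvf => ?_
      exact hM.2 e he f hf hef v ⟨Sym2.mem_toFinset.1 hve, Sym2.mem_toFinset.1 hvf⟩
  rw [Finset.sum_const, smul_eq_mul, mul_comm] at h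
  exact h ▸ Finset.card_le_univ _

/-- The involution exchanging the endpoints of each edge of a matching. -/
def matchingPartner (M : Finset (Sym2 V)) (v : V) : V :=
  if h : ∃ w, s(v, w) ∈ M then h.choose else v

lemma IsMatchingSet.mem_iff_partner {G : SimpleGraph V} {M : Finset (Sym2 V)}
    (hM : IsMatchingSet G M) (v w : V) :
    s(v, w) ∈ M ↔ v ≠ w ∧ matchingPartner M v = w := by
  unfold matchingPartner
  split_ifs with h
  · constructor
    · exact fun hvw => ⟨hM.ne hvw, hM.eq_right h.choose_spec hvw⟩
    · rintro ⟨-, rfl⟩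
      exact h.choose_spec
  · exact ⟨fun hvw => absurd ⟨w, hvw⟩ h, fun hvw => absurd hvw.2 hvw.1⟩

lemma card_matchingsOf_le [Fintype V] (G : SimpleGraph V) :
    #(matchingsOf G) ≤ Fintype.card V ^ Fintype.card V := by
  have hinj : Set.InjOn (matchingPartner (V := V)) (matchingsOf G) := by
    intro M hM N hN hMN
    have hM := mem_matchingsOf.1 hM
    have hN := mem_matchingsOf.1 hN
    ext e
    induction e with
    | _ v w => rw [hM.mem_iff_partner, hN.mem_iff_partner, hMN]
  calc #(matchingsOf G) ≤ #(Finset.univ : Finset (V → V)) :=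
        Finset.card_le_card_of_injOn _ (fun _ _ => Finset.mem_univ _) hinj
    _ = _ := by simp

lemma matchingGen_le [Fintype V] (G : SimpleGraph V) {lam : ℝ} (hlam : 1 ≤ lam) :
    matchingGen G lam ≤
      (Fintype.card V : ℝ) ^ Fintype.card V * lam ^ (Fintype.card V / 2) := by
  calc matchingGen G lam ≤ ∑ M ∈ matchingsOf G, lam ^ (Fintype.card V / 2) := by
        refine Finset.sum_le_sum fun M hM => pow_le_pow_right₀ hlam ?_
        have := (mem_matchingsOf.1 hM).two_mul_card_le
        omega
    _ = (#(matchingsOf G) : ℝ) * lam ^ (Fintype.card V / 2) := by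
        rw [Finset.sum_const, nsmul_eq_mul]
    _ ≤ _ := by
        gcongr
        exact_mod_cast card_matchingsOf_le G

lemma pow_card_le_matchingGen [Fintype V] {G : SimpleGraph V} {M : Finset (Sym2 V)}
    (hM : IsMatchingSet G M) {lam : ℝ} (hlam : 0 ≤ lam) : lam ^ #M ≤ matchingGen G lam :=
  Finset.single_le_sum (f := fun M : Finset (Sym2 V) => lam ^ #M)
    (fun _ _ => pow_nonneg hlam _) (mem_matchingsOf.2 hM)

lemma one_le_matchingGen [Fintype V] (G : SimpleGraph V) {lam : ℝ} (hlam : 0 ≤ lam) :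
    1 ≤ matchingGen G lam := by
  simpa using pow_card_le_matchingGen (IsMatchingSet.empty G) hlam

lemma IsMatchingSet.image {W : Type*} {H : SimpleGraph W} {G : SimpleGraph V} (f : H →g G)
    (hf : Function.Injective f) {M : Finset (Sym2 W)} (hM : IsMatchingSet H M) :
    IsMatchingSet G (M.image (Sym2.map f)) := by
  constructor
  · intro e he
    obtain ⟨a, ha, rfl⟩ := Finset.mem_image.1 he
    exact f.map_mem_edgeSet (hM.1 a ha)
  · rintro e he e' he' hne v ⟨hv, hv'⟩
    obtain ⟨a, ha, rfl⟩ := Finset.mem_image.1 he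
    obtain ⟨b, hb, rfl⟩ := Finset.mem_image.1 he'
    obtain ⟨x, hx, rfl⟩ := Sym2.mem_map.1 hv
    obtain ⟨y, hy, hxy⟩ := Sym2.mem_map.1 hv'
    obtain rfl := hf hxy
    exact hM.2 a ha b hb (fun h => hne (by rw [h])) y ⟨hx, hy⟩

/-- The matching polynomial dominates the product over two disjointly embedded graphs. -/
lemma matchingGen_mul_le {W₁ W₂ : Type*} [Fintype V] [Fintype W₁] [Fintype W₂]
    {G : SimpleGraph V} {G₁ : SimpleGraph W₁} {G₂ : SimpleGraph W₂} (f : G₁ →g G) (g : G₂ →g G)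
    (hf : Function.Injective f) (hg : Function.Injective g) (hfg : ∀ a b, f a ≠ g b)
    {lam : ℝ} (hlam : 0 ≤ lam) :
    matchingGen G₁ lam * matchingGen G₂ lam ≤ matchingGen G lam := by
  have hdis : ∀ a b (v : V), ¬ (v ∈ Sym2.map f a ∧ v ∈ Sym2.map g b) := by
    rintro a b v ⟨ha, hb⟩
    obtain ⟨x, -, rfl⟩ := Sym2.mem_map.1 ha
    obtain ⟨y, -, hy⟩ := Sym2.mem_map.1 hb
    exact hfg x y hy.symm
  have hne : ∀ a b, Sym2.map f a ≠ Sym2.map g b := fun a b h =>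
    hdis a b _ ⟨Sym2.out_fst_mem _, h ▸ Sym2.out_fst_mem _⟩
  have hf' := Sym2.map.injective hf
  have hg' := Sym2.map.injective hg
  let φ : Finset (Sym2 W₁) × Finset (Sym2 W₂) → Finset (Sym2 V) := fun M =>
    M.1.image (Sym2.map f) ∪ M.2.image (Sym2.map g)
  have hφ₁ : ∀ M a, Sym2.map f a ∈ φ M ↔ a ∈ M.1 := by
    intro M a
    simp only [φ, Finset.mem_union, hf'.mem_finset_image, Finset.mem_image, or_iff_left_iff_imp]
    rintro ⟨b, -, hb⟩
    exact absurd hb.symm (hne a b)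
  have hφ₂ : ∀ M b, Sym2.map g b ∈ φ M ↔ b ∈ M.2 := by
    intro M b
    simp only [φ, Finset.mem_union, hg'.mem_finset_image, Finset.mem_image, or_iff_right_iff_imp]
    rintro ⟨a, -, ha⟩
    exact absurd ha (hne a b)
  have hφinj : Function.Injective φ := by
    intro M N hMN
    refine Prod.ext (Finset.ext fun a => ?_) (Finset.ext fun b => ?_)
    · rw [← hφ₁, hMN, hφ₁]
    · rw [← hφ₂, hMN, hφ₂]
  have hcard : ∀ M, #(φ M) = #M.1 + #M.2 := by
    intro M
    rw [Finset.card_union_of_disjoint, Finset.card_image_of_injective _ hf',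
      Finset.card_image_of_injective _ hg']
    refine Finset.disjoint_left.2 fun e he he' => ?_
    obtain ⟨a, -, rfl⟩ := Finset.mem_image.1 he
    obtain ⟨b, -, hb⟩ := Finset.mem_image.1 he'
    exact hne a b hb.symm
  have hmatch : ∀ M ∈ matchingsOf G₁ ×ˢ matchingsOf G₂, φ M ∈ matchingsOf G := by
    intro M hM
    rw [Finset.mem_product] at hM
    have h₁ := (mem_matchingsOf.1 hM.1).image f hf
    have h₂ := (mem_matchingsOf.1 hM.2).image g hg
    refine mem_matchingsOf.2 ⟨fun e he => (Finset.mem_union.1 he).elim (h₁.1 e) (h₂.1 e), ?_⟩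
    intro e he e' he' hee v hv
    rcases Finset.mem_union.1 he with h | h <;> rcases Finset.mem_union.1 he' with h' | h'
    · exact h₁.2 e h e' h' hee v hv
    · obtain ⟨a, -, rfl⟩ := Finset.mem_image.1 h
      obtain ⟨b, -, rfl⟩ := Finset.mem_image.1 h'
      exact hdis a b v hv
    · obtain ⟨b, -, rfl⟩ := Finset.mem_image.1 h
      obtain ⟨a, -, rfl⟩ := Finset.mem_image.1 h'
      exact hdis a b v hv.symm
    · exact h₂.2 e h e' h' hee v hv
  calc matchingGen G₁ lam * matchingGen G₂ lam
      = ∑ M ∈ matchingsOf G₁ ×ˢ matchingsOf G₂, lam ^ #(φ M) := by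
        simp only [matchingGen, Finset.sum_mul_sum, Finset.sum_product, hcard, pow_add]
    _ = ∑ N ∈ (matchingsOf G₁ ×ˢ matchingsOf G₂).image φ, lam ^ #N :=
        (Finset.sum_image (f := fun N => lam ^ #N) hφinj.injOn).symm
    _ ≤ matchingGen G lam :=
        Finset.sum_le_sum_of_subset_of_nonneg (Finset.image_subset_iff.2 hmatch)
          fun _ _ _ => pow_nonneg hlam _

end MatchingGen

section Main

open scoped Classical

lemma q_pow_le_pow {d : ℕ} (hd : Even d) {lam : ℝ} (hlam1 : 1 ≤ lam)
    (hlam : ((d : ℝ) + 1) ^ ((d + 1) * (d + 3)) ≤ lam) :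
    q (d + 1) lam ^ (2 * (d + 3)) ≤ lam ^ ((d + 1) * (d + 2)) := by
  obtain ⟨k, rfl⟩ := hd
  have hq0 : 0 ≤ q (k + k + 1) lam :=
    zero_le_one.trans (one_le_matchingGen _ (zero_le_one.trans hlam1))
  have hq : q (k + k + 1) lam ≤ (((k + k : ℕ) : ℝ) + 1) ^ (k + k + 1) * lam ^ k := by
    have := matchingGen_le (⊤ : SimpleGraph (Fin (k + k + 1))) hlam1
    rw [Fintype.card_fin, show (k + k + 1) / 2 = k by omega, Nat.cast_add_one] at this
    exact this
  have hc : 0 ≤ ((k + k : ℕ) : ℝ) + 1 := by positivity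
  generalize ((k + k : ℕ) : ℝ) + 1 = c at *
  calc q (k + k + 1) lam ^ (2 * (k + k + 3))
      ≤ (c ^ (k + k + 1) * lam ^ k) ^ (2 * (k + k + 3)) := pow_le_pow_left₀ hq0 hq _
    _ = (c ^ ((k + k + 1) * (k + k + 3))) ^ 2 * lam ^ (k * (2 * (k + k + 3))) := by ring
    _ ≤ lam ^ 2 * lam ^ (k * (2 * (k + k + 3))) := by
        gcongr
    _ = lam ^ ((k + k + 1) * (k + k + 2)) := by ring

lemma q_pow_card_le_of_no_clique_component {V : Type*} [Fintype V] {G : SimpleGraph V} {d : ℕ}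
    (hd : Even d) (hd2 : 2 ≤ d) {lam : ℝ} (hlam1 : 1 ≤ lam)
    (hlam : ((d : ℝ) + 1) ^ ((d + 1) * (d + 3)) ≤ lam)
    (hreg : ∀ v, #{w | G.Adj v w} = d)
    (hcl : ∀ B : Finset V, #B = d + 1 → ¬ ∀ v ∈ B, ∀ w, G.Adj v w → w ∈ B) :
    q (d + 1) lam ^ Fintype.card V ≤ matchingGen G lam ^ (d + 1) := by
  have h0 : 0 ≤ lam := zero_le_one.trans hlam1
  have hq0 : 0 ≤ q (d + 1) lam := zero_le_one.trans (one_le_matchingGen _ h0)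
  obtain ⟨M, hM, hcard⟩ := exists_large_matching hd hd2 hreg hcl
  refine le_trans ?_ (pow_le_pow_left₀ (pow_nonneg h0 _) (pow_card_le_matchingGen hM h0) (d + 1))
  refine le_of_pow_le_pow_left₀ (n := 2 * (d + 3)) (by omega) (by positivity) ?_
  calc (q (d + 1) lam ^ Fintype.card V) ^ (2 * (d + 3))
      = (q (d + 1) lam ^ (2 * (d + 3))) ^ Fintype.card V := by
        rw [← pow_mul, ← pow_mul, mul_comm]
    _ ≤ (lam ^ ((d + 1) * (d + 2))) ^ Fintype.card V :=
        pow_le_pow_left₀ (pow_nonneg hq0 _) (q_pow_le_pow hd hlam1 hlam) _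
    _ = lam ^ ((d + 1) * ((d + 2) * Fintype.card V)) := by rw [← pow_mul, mul_assoc]
    _ ≤ lam ^ ((d + 1) * (2 * (d + 3) * #M)) :=
        pow_le_pow_right₀ hlam1 (Nat.mul_le_mul_left _ hcard)
    _ = ((lam ^ #M) ^ (d + 1)) ^ (2 * (d + 3)) := by
        rw [← pow_mul, ← pow_mul]
        congr 1
        ring

lemma adj_of_closed_of_card {V : Type*} [Fintype V] {G : SimpleGraph V} {d : ℕ}
    (hreg : ∀ v, #{w | G.Adj v w} = d) {B : Finset V} (hB : #B = d + 1)
    (hcl : ∀ v ∈ B, ∀ w, G.Adj v w → w ∈ B) {v w : V} (hv : v ∈ B) (hw : w ∈ B) (hvw : v ≠ w) :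
    G.Adj v w := by
  have hsub : Finset.univ.filter (G.Adj v) ⊆ B.erase v := fun x hx => by
    have hx := (Finset.mem_filter.1 hx).2
    exact Finset.mem_erase.2 ⟨hx.ne', hcl v hv x hx⟩
  have heq := Finset.eq_of_subset_of_card_le hsub
    (by rw [hreg v, Finset.card_erase_of_mem hv, hB, Nat.add_sub_cancel])
  have : w ∈ Finset.univ.filter (G.Adj v) := heq ▸ Finset.mem_erase.2 ⟨hvw.symm, hw⟩
  exact (Finset.mem_filter.1 this).2

universe u

lemma q_pow_card_le {d : ℕ} (hd : Even d) (hd2 : 2 ≤ d) {lam : ℝ} (hlam1 : 1 ≤ lam)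
    (hlam : ((d : ℝ) + 1) ^ ((d + 1) * (d + 3)) ≤ lam) (n : ℕ) :
    ∀ {V : Type u} [Fintype V] (G : SimpleGraph V), Fintype.card V = n →
      (∀ v, #{w | G.Adj v w} = d) → q (d + 1) lam ^ n ≤ matchingGen G lam ^ (d + 1) := by
  induction n using Nat.strong_induction_on with
  | _ n ih =>
  intro V _ G hn hreg
  by_cases hcl : ∀ B : Finset V, #B = d + 1 → ¬ ∀ v ∈ B, ∀ w, G.Adj v w → w ∈ B
  · exact hn ▸ q_pow_card_le_of_no_clique_component hd hd2 hlam1 hlam hreg hcl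
  push Not at hcl
  obtain ⟨B, hB, hcl⟩ := hcl
  have h0 : 0 ≤ lam := zero_le_one.trans hlam1
  have hq0 : 0 ≤ q (d + 1) lam := zero_le_one.trans (one_le_matchingGen _ h0)
  let G' : SimpleGraph {v // v ∉ B} := G.comap Subtype.val
  have hcard : Fintype.card {v // v ∉ B} + (d + 1) = n := by
    have hle := Finset.card_le_univ B
    rw [Fintype.card_subtype_compl, Fintype.card_coe]
    omega
  have hreg' : ∀ v, #{w | G'.Adj v w} = d := by
    intro v
    rw [← hreg v, ← Finset.card_map (Function.Embedding.subtype _)]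
    congr 1
    ext w
    simp only [Finset.mem_map, Finset.mem_filter, Finset.mem_univ, true_and]
    constructor
    · rintro ⟨x, hx, rfl⟩
      exact hx
    · exact fun hvw => ⟨⟨w, fun hw => v.2 (hcl w hw v hvw.symm)⟩, hvw, rfl⟩
  have hIH := ih _ (by omega) G' rfl hreg'
  let ψ : Fin (d + 1) ≃ B := (Fintype.equivFinOfCardEq (by simpa using hB)).symm
  let f : (⊤ : SimpleGraph (Fin (d + 1))) →g G :=
    { toFun := fun i => ψ i
      map_rel' := fun {a b} hab => adj_of_closed_of_card hreg hB hcl (ψ a).2 (ψ b).2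
        fun h => hab (ψ.injective (Subtype.ext h)) }
  let g : G' →g G := ⟨Subtype.val, fun h => h⟩
  have hmul : q (d + 1) lam * matchingGen G' lam ≤ matchingGen G lam :=
    matchingGen_mul_le f g (Subtype.val_injective.comp ψ.injective) Subtype.val_injective
      (fun a b (h : (ψ a : V) = b) => b.2 (h ▸ (ψ a).2)) h0
  calc q (d + 1) lam ^ n
      = q (d + 1) lam ^ (d + 1) * q (d + 1) lam ^ Fintype.card {v // v ∉ B} := by
        rw [← pow_add, ← hcard, add_comm (d + 1)]
    _ ≤ q (d + 1) lam ^ (d + 1) * matchingGen G' lam ^ (d + 1) := by gcongr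
    _ = (q (d + 1) lam * matchingGen G' lam) ^ (d + 1) := (mul_pow _ _ _).symm
    _ ≤ matchingGen G lam ^ (d + 1) :=
        pow_le_pow_left₀ (mul_nonneg hq0 (zero_le_one.trans (one_le_matchingGen _ h0))) hmul _

end Main

/-- for even `d` and `λ ≥ exp((d+1)(d+3)·ln(d+1))`, every
`d`-regular graph `G` satisfies
`(1/v(G))·ln M_G(λ) ≥ (1/(d+1))·ln M_{K_{d+1}}(λ)`. -/
theorem min_partition_even_degree_large_lambda {V : Type*} [Fintype V] [Nonempty V]
    (d : ℕ) (hdev : Even d) (lam : ℝ)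
    (hlam : Real.exp (((d : ℝ) + 1) * ((d : ℝ) + 3) * Real.log ((d : ℝ) + 1)) ≤ lam)
    (G : SimpleGraph V) [DecidableRel G.Adj] (hreg : G.IsRegularOfDegree d) :
    (1 / ((d : ℝ) + 1)) * Real.log (q (d + 1) lam) ≤
      (1 / (Fintype.card V : ℝ)) * Real.log (matchingGen G lam) := by
  classical
  have hd0 : (0 : ℝ) < (d : ℝ) + 1 := by positivity
  have hlam' : ((d : ℝ) + 1) ^ ((d + 1) * (d + 3)) ≤ lam := by
    refine le_of_eq_of_le ?_ hlam
    rw [mul_comm (((d : ℝ) + 1) * ((d : ℝ) + 3)), ← Real.rpow_def_of_pos hd0,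
      ← Real.rpow_natCast]
    push_cast
    rfl
  have hlam1 : 1 ≤ lam := (one_le_pow₀ (by simp)).trans hlam'
  have h0 : 0 ≤ lam := zero_le_one.trans hlam1
  have hq1 : 1 ≤ q (d + 1) lam := one_le_matchingGen _ h0
  have hpow : q (d + 1) lam ^ Fintype.card V ≤ matchingGen G lam ^ (d + 1) := by
    rcases Nat.lt_or_ge d 2 with hd | hd
    · obtain rfl : d = 0 := by
        obtain ⟨k, rfl⟩ := hdev
        omega
      have hq : q (0 + 1) lam ≤ 1 := by
        simpa using! matchingGen_le (⊤ : SimpleGraph (Fin 1)) hlam1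
      exact (pow_le_one₀ (zero_le_one.trans hq1) hq).trans
        (one_le_pow₀ (one_le_matchingGen G h0))
    · refine q_pow_card_le hdev hd hlam1 hlam' _ G rfl fun v => ?_
      rw [← hreg v, ← SimpleGraph.card_neighborFinset_eq_degree]
      congr 1
      ext w
      simp
  have hlog := Real.log_le_log (pow_pos (zero_lt_one.trans_le hq1) _) hpow
  rw [Real.log_pow, Real.log_pow] at hlog
  have hV : (0 : ℝ) < Fintype.card V := by exact_mod_cast Fintype.card_pos
  rw [one_div_mul_eq_div, one_div_mul_eq_div, div_le_div_iff₀ hd0 hV]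
  push_cast at hlog
  linarith
end
end
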